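/- Let H = 1/2 and d < 0. Set ρ₁ = arcosh((1 + d²)/(−2d)) and define λ(ρ) = ∫_{ρ₁}^{ρ} (d + cosh r)/√(−2d cosh r − 1 − d²) dr. Then the integrand is integrable on [ρ₁, ρ] for every ρ > ρ₁, and λ(ρ) → +∞ as ρ → +∞. -/

import Mathlib

noncomputable def arcosh (x : ℝ) : ℝ := Real.log (x + Real.sqrt (x^2 - 1))

theorem arcosh_eq_real_arcosh (x : ℝ) : arcosh x = Real.arcosh x := rfl

theorem one_le_one_add_sq_div {d : ℝ} (hd : d < 0) : 1 ≤ (1 + d^2)/(-2*d) := by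
  rw [le_div_iff₀ (by linarith)]
  nlinarith [sq_nonneg (d + 1)]

/-- The radicand `-2 d cosh r - 1 - d²` is positive to the right of its zero. -/
theorem radicand_pos {d : ℝ} (hd : d < 0) {r : ℝ} (hr : arcosh ((1 + d^2)/(-2*d)) < r) :
    0 < -2*d*Real.cosh r - 1 - d^2 := by
  have h1 := one_le_one_add_sq_div hd
  rw [arcosh_eq_real_arcosh] at hr
  have h0 := Real.arcosh_nonneg h1
  have hc : Real.cosh (Real.arcosh ((1 + d^2)/(-2*d))) < Real.cosh r := by
    rw [Real.cosh_lt_cosh, abs_of_nonneg h0, abs_of_pos (h0.trans_lt hr)]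
    exact hr
  rw [Real.cosh_arcosh h1, div_lt_iff₀ (by linarith)] at hc
  linarith

theorem intervalIntegrable_slope {d : ℝ} (hd : d < 0) {ρ : ℝ}
    (hρ : arcosh ((1 + d^2)/(-2*d)) < ρ) :
    IntervalIntegrable
      (fun r => (d + Real.cosh r) / Real.sqrt (-2*d*Real.cosh r - 1 - d^2))
      MeasureTheory.volume (arcosh ((1 + d^2)/(-2*d))) ρ := by
  by_cases hd1 : d = -1
  · have h : (fun r => (d + Real.cosh r) / Real.sqrt (-2*d*Real.cosh r - 1 - d^2)) =
        fun r => Real.sqrt (2 * (Real.cosh r - 1)) / 2 := by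
      funext r
      rw [← Real.div_sqrt (x := 2 * (Real.cosh r - 1)), hd1]
      ring_nf
    rw [h]
    exact Continuous.intervalIntegrable (by fun_prop) _ _
  · have h1 : 1 < (1 + d^2)/(-2*d) := by
      rw [lt_div_iff₀ (by linarith)]
      have : 0 < (d + 1)^2 := by
        have : d + 1 ≠ 0 := fun h => hd1 (by linarith)
        positivity
      nlinarith
    have hpos : 0 < arcosh ((1 + d^2)/(-2*d)) := Real.arcosh_pos h1
    have hderiv : ∀ r ∈ Set.Ioo (arcosh ((1 + d^2)/(-2*d))) ρ,
        HasDerivAt (fun r => Real.sqrt (-2*d*Real.cosh r - 1 - d^2))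
          (-2*d*Real.sinh r / (2 * Real.sqrt (-2*d*Real.cosh r - 1 - d^2))) r := by
      intro r hr
      exact ((((Real.hasDerivAt_cosh r).const_mul (-2*d)).sub_const 1).sub_const (d^2)).sqrt
        (radicand_pos hd hr.1).ne'
    have hint : IntervalIntegrable
        (fun r => -2*d*Real.sinh r / (2 * Real.sqrt (-2*d*Real.cosh r - 1 - d^2)))
        MeasureTheory.volume (arcosh ((1 + d^2)/(-2*d))) ρ := by
      rw [intervalIntegrable_iff_integrableOn_Ioc_of_le hρ.le]
      refine intervalIntegral.integrableOn_deriv_of_nonneg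
        (Continuous.continuousOn (by fun_prop)) hderiv fun r hr => ?_
      have := Real.sinh_pos_iff.2 (hpos.trans hr.1)
      have : 0 < -2*d := by linarith
      positivity
    have hcont : ContinuousOn (fun r => (d + Real.cosh r) / (-d * Real.sinh r))
        (Set.uIcc (arcosh ((1 + d^2)/(-2*d))) ρ) := by
      refine ContinuousOn.div (by fun_prop) (by fun_prop) fun r hr => ?_
      rw [Set.uIcc_of_le hρ.le] at hr
      have := Real.sinh_pos_iff.2 (hpos.trans_le hr.1)
      exact mul_ne_zero (by linarith) this.ne'
    refine (hint.mul_continuousOn hcont).congr fun r hr => ?_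
    rw [Set.uIoc_of_le hρ.le] at hr
    have hs := (Real.sinh_pos_iff.2 (hpos.trans hr.1)).ne'
    have hq := (Real.sqrt_pos.2 (radicand_pos hd hr.1)).ne'
    have hd0 := hd.ne
    generalize Real.sqrt (-2*d*Real.cosh r - 1 - d^2) = q at *
    field_simp

theorem one_le_slope {d : ℝ} (hd : d < 0) {r : ℝ} (hr : arcosh ((1 + d^2)/(-2*d)) < r)
    (hr' : -4*d ≤ r) :
    1 ≤ (d + Real.cosh r) / Real.sqrt (-2*d*Real.cosh r - 1 - d^2) := by
  have hc : -4*d ≤ Real.cosh r :=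
    hr'.trans ((Real.self_le_sinh_iff.2 (by linarith)).trans (Real.sinh_lt_cosh r).le)
  rw [one_le_div (Real.sqrt_pos.2 (radicand_pos hd hr))]
  refine Real.sqrt_le_iff.2 ⟨by linarith, ?_⟩
  nlinarith [mul_nonneg (by linarith : 0 ≤ Real.cosh r) (by linarith : 0 ≤ Real.cosh r + 4*d)]

theorem stmt_10 (d : ℝ) (hd : d < 0) :
    (∀ ρ : ℝ, arcosh ((1 + d^2)/(-2*d)) < ρ →
      IntervalIntegrable
        (fun r => (d + Real.cosh r) / Real.sqrt (-2*d*Real.cosh r - 1 - d^2))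
        MeasureTheory.volume (arcosh ((1 + d^2)/(-2*d))) ρ) ∧
    Filter.Tendsto
      (fun ρ => ∫ r in (arcosh ((1 + d^2)/(-2*d)))..ρ,
        (d + Real.cosh r) / Real.sqrt (-2*d*Real.cosh r - 1 - d^2))
      Filter.atTop Filter.atTop := by
  refine ⟨fun ρ hρ => intervalIntegrable_slope hd hρ, ?_⟩
  obtain ⟨R, hR, hR'⟩ : ∃ R, arcosh ((1 + d^2)/(-2*d)) < R ∧ -4*d ≤ R :=
    ⟨max (arcosh ((1 + d^2)/(-2*d)) + 1) (-4*d),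
      (lt_add_one _).trans_le (le_max_left _ _), le_max_right _ _⟩
  have hIR := intervalIntegrable_slope hd hR
  refine Filter.tendsto_atTop_mono' Filter.atTop ?_
    (Filter.tendsto_atTop_add_const_left Filter.atTop
      (∫ r in (arcosh ((1 + d^2)/(-2*d)))..R,
        (d + Real.cosh r) / Real.sqrt (-2*d*Real.cosh r - 1 - d^2))
      (Filter.tendsto_atTop_add_const_right Filter.atTop (-R) Filter.tendsto_id))
  filter_upwards [Filter.eventually_ge_atTop R] with ρ hρ
  have hIρ := hIR.symm.trans (intervalIntegrable_slope hd (hR.trans_le hρ))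
  rw [← intervalIntegral.integral_add_adjacent_intervals hIR hIρ]
  have h := intervalIntegral.integral_mono_on hρ
    (intervalIntegrable_const (c := (1 : ℝ))) hIρ
    fun r hr => one_le_slope hd (hR.trans_le hr.1) (hR'.trans hr.1)
  rw [intervalIntegral.integral_const, smul_eq_mul, mul_one] at h
  simp only [id]
  linarith
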